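/- For every positive integer n ≥ 1, ζ(2n+1) = (-1)^n · π^{2n} · 2^{1+2n} · { (1/(2n+1)!) · (3/2)^{2n+1} · ( ln(3/2) - 1/(2n+1) ) - ∑_{k=1}^{n-1} ( A(n,k) + ζ'(-2n+2k) ) / ( (2n-2k)! · (2k+1)! · 2^{2k} ) - ( 3·A(n,n) - ln(2π) ) / ( (2n+1)! · 2^{2n+1} ) - (1/2^{2n}) · ∑_{l=1}^∞ (ζ(2l) - 1) / ( 2^{2l} · ∏_{r=0}^{2n+1} (2l + r) ) }, where A(n,k) = ∑_{r=0}^{2k-1} 1/(2n - r), and for n = 1 the sum over k is empty. -/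

import Mathlib

open Real

/-- `A(n,k) = ∑_{r=0}^{2k-1} 1/(2n - r)`. -/
noncomputable def A (n k : ℕ) : ℝ :=
  ∑ r ∈ Finset.range (2 * k), 1 / (2 * (n : ℝ) - (r : ℝ))

/-- The regular part `1/x - π cot(πx)` of the cotangent at the origin. -/
noncomputable def cotDefect (x : ℝ) : ℝ := 1 / x - π * cos (π * x) / sin (π * x)

/-- The values `ζ(s)` at natural numbers, as a real series. -/
noncomputable def zetaNat (s : ℕ) : ℝ := ∑' m : ℕ, 1 / ((m : ℝ) + 1) ^ s

lemma hasSum_zetaNat {s : ℕ} (hs : 2 ≤ s) :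
    HasSum (fun m : ℕ => 1 / ((m : ℝ) + 1) ^ s) (zetaNat s) := by
  have h := (summable_nat_add_iff 1).2 (Real.summable_one_div_nat_pow.2 (by omega : 1 < s))
  simpa [zetaNat] using h.hasSum

lemma riemannZeta_eq_zetaNat {s : ℕ} (hs : 2 ≤ s) : riemannZeta s = (zetaNat s : ℂ) := by
  rw [zeta_nat_eq_tsum_of_gt_one (by omega), zetaNat, Complex.ofReal_tsum,
    ← Summable.sum_add_tsum_nat_add 1]
  · simp [show s ≠ 0 by omega]
  · have h := Complex.summable_ofReal.2 (Real.summable_one_div_nat_pow.2 (by omega : 1 < s))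
    simpa using h

lemma hasSum_cotDefect_partialFractions {x : ℝ} (h0 : 0 < x) (h1 : x < 1) :
    HasSum (fun m : ℕ => 2 * x / (((m : ℝ) + 1) ^ 2 - x ^ 2)) (cotDefect x) := by
  have hx : (x : ℂ) ∈ Complex.integerComplement := by
    rintro ⟨k, hk⟩
    have hk' : (k : ℝ) = x := by exact_mod_cast hk
    rw [← hk'] at h0 h1
    have : 0 < k := by exact_mod_cast h0
    have : k < 1 := by exact_mod_cast h1
    omega
  have h := (summable_cotTerm hx).hasSum
  simp only [cotTerm, ← cot_series_rep' hx] at h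
  rw [← Complex.hasSum_ofReal]
  convert! h.neg using 1
  · ext m
    have hm : (0 : ℝ) ≤ m := m.cast_nonneg
    have e1 : (x : ℂ) - (m + 1) ≠ 0 := by
      exact_mod_cast (show x - ((m : ℝ) + 1) ≠ 0 by linarith)
    have e2 : (x : ℂ) + (m + 1) ≠ 0 := by
      exact_mod_cast (show x + ((m : ℝ) + 1) ≠ 0 by linarith)
    have e3 : ((m : ℂ) + 1) ^ 2 - x ^ 2 ≠ 0 := by
      rw [show ((m : ℂ) + 1) ^ 2 - x ^ 2 = -(x - (m + 1)) * (x + (m + 1)) by ring]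
      exact mul_ne_zero (neg_ne_zero.2 e1) e2
    push_cast
    field_simp
    ring
  · rw [cotDefect, Complex.cot]
    push_cast
    ring

lemma hasSum_cotDefect {x : ℝ} (h0 : 0 ≤ x) (h1 : x < 1) :
    HasSum (fun l : ℕ => 2 * zetaNat (2 * l + 2) * x ^ (2 * l + 1)) (cotDefect x) := by
  rcases h0.eq_or_lt with rfl | h0
  · simp [cotDefect]
  have hm (m : ℕ) : HasSum (fun l : ℕ => 2 * x ^ (2 * l + 1) * (1 / ((m : ℝ) + 1) ^ (2 * l + 2)))
      (2 * x / (((m : ℝ) + 1) ^ 2 - x ^ 2)) := by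
    have hp : (0 : ℝ) < (m : ℝ) + 1 := by positivity
    have hxm : x < (m : ℝ) + 1 := by linarith [m.cast_nonneg (α := ℝ)]
    have hlt : x ^ 2 / ((m : ℝ) + 1) ^ 2 < 1 := by
      rw [div_lt_one (by positivity)]
      gcongr
    have h := (hasSum_geometric_of_lt_one (by positivity) hlt).mul_left (2 * x / ((m : ℝ) + 1) ^ 2)
    convert! h using 1
    · ext l
      rw [div_pow, ← pow_mul, ← pow_mul, pow_succ x, pow_add ((m : ℝ) + 1)]
      field_simp
    · have : ((m : ℝ) + 1) ^ 2 - x ^ 2 ≠ 0 := by nlinarith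
      have : 1 - x ^ 2 / ((m : ℝ) + 1) ^ 2 ≠ 0 := by linarith
      field_simp
  have hs := hasSum_cotDefect_partialFractions h0 h1
  let f : ℕ × ℕ → ℝ := fun p => 2 * x ^ (2 * p.2 + 1) * (1 / ((p.1 : ℝ) + 1) ^ (2 * p.2 + 2))
  have hf : Summable f := by
    rw [summable_prod_of_nonneg (fun p => by positivity)]
    refine ⟨fun m => (hm m).summable, ?_⟩
    simpa only [f, (hm _).tsum_eq] using hs.summable
  have hfs : HasSum f (cotDefect x) := by
    rw [hs.unique (hf.hasSum.prod_fiberwise hm)]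
    exact hf.hasSum
  have hsw : HasSum (f ∘ Prod.swap) (cotDefect x) := (Equiv.prodComm ℕ ℕ).hasSum_iff.2 hfs
  refine hsw.prod_fiberwise fun l => ?_
  convert! (hasSum_zetaNat (s := 2 * l + 2) (by omega)).mul_left (2 * x ^ (2 * l + 1)) using 1
  ring

lemma zetaNat_nonneg (s : ℕ) : 0 ≤ zetaNat s := tsum_nonneg fun _ => by positivity

lemma one_le_zetaNat {s : ℕ} (hs : 2 ≤ s) : 1 ≤ zetaNat s := by
  simpa [zetaNat] using (hasSum_zetaNat hs).summable.le_tsum 0 fun _ _ => by positivity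

lemma continuousOn_cotDefect : ContinuousOn cotDefect (Set.Icc 0 (1 / 2)) := by
  have h := continuousOn_tsum (s := Set.Icc (0 : ℝ) (1 / 2))
    (f := fun (l : ℕ) (x : ℝ) => 2 * zetaNat (2 * l + 2) * x ^ (2 * l + 1))
    (fun l => by fun_prop)
    (hasSum_cotDefect (x := 1 / 2) (by norm_num) (by norm_num)).summable
    (fun l x hx => by
      have := zetaNat_nonneg (2 * l + 2)
      rw [Real.norm_of_nonneg (mul_nonneg (by positivity) (pow_nonneg hx.1 _))]
      have := pow_le_pow_left₀ hx.1 hx.2 (2 * l + 1)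
      gcongr)
  exact h.congr fun x hx =>
    (hasSum_cotDefect hx.1 (by linarith [hx.2])).tsum_eq.symm

lemma integral_sub_pow_mul_pow (c : ℝ) (N p : ℕ) :
    ∫ x in (0 : ℝ)..c, (c - x) ^ N * x ^ p =
      c ^ (N + p + 1) * (N.factorial * p.factorial / (N + p + 1).factorial) := by
  induction N generalizing p with
  | zero =>
    simp only [pow_zero, one_mul, integral_pow, Nat.factorial_succ, zero_add]
    have := p.factorial_ne_zero
    push_cast
    field_simp
    simp
  | succ N ih =>
    have hd (x : ℝ) (_ : x ∈ Set.uIcc 0 c) :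
        HasDerivAt (fun x : ℝ => (c - x) ^ (N + 1) * x ^ (p + 1))
          (-((N + 1) * ((c - x) ^ N * x ^ (p + 1))) + (p + 1) * ((c - x) ^ (N + 1) * x ^ p)) x := by
      convert! (((hasDerivAt_id x).const_sub c).pow (N + 1)).mul ((hasDerivAt_id x).pow (p + 1))
        using 1
      simp
      ring
    have h := intervalIntegral.integral_eq_sub_of_hasDerivAt hd
      (by apply Continuous.intervalIntegrable; fun_prop)
    rw [intervalIntegral.integral_add (by apply Continuous.intervalIntegrable; fun_prop)
      (by apply Continuous.intervalIntegrable; fun_prop), intervalIntegral.integral_neg,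
      intervalIntegral.integral_const_mul, intervalIntegral.integral_const_mul, ih] at h
    simp only [sub_self, ne_eq, Nat.add_eq_zero_iff, one_ne_zero, and_false, not_false_eq_true,
      zero_pow, mul_zero, zero_mul] at h
    have hp : ((p : ℝ) + 1) ≠ 0 := by positivity
    apply mul_left_cancel₀ hp
    rw [show N + 1 + p + 1 = N + (p + 1) + 1 by ring, Nat.factorial_succ p,
      Nat.factorial_succ N] at *
    push_cast at *
    linear_combination h
lemma sum_choose_mul_harmonic_succ (a d : ℝ) (N : ℕ) :
    ∑ i ∈ Finset.range (N + 2), ((N + 1).choose i : ℝ) * d ^ i * a ^ (N + 1 - i) *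
        (harmonic (N + 1 - i) : ℝ) =
      (a + d) * ∑ i ∈ Finset.range (N + 1), (N.choose i : ℝ) * d ^ i * a ^ (N - i) *
        (harmonic (N - i) : ℝ) + ((a + d) ^ (N + 1) - d ^ (N + 1)) / (N + 1) := by
  have hN : (N : ℝ) + 1 ≠ 0 := by positivity
  have h1 : ∑ i ∈ Finset.range (N + 2), (N.choose i : ℝ) * d ^ i * a ^ (N + 1 - i) *
        (harmonic (N + 1 - i) : ℝ) =
      a * (∑ i ∈ Finset.range (N + 1), (N.choose i : ℝ) * d ^ i * a ^ (N - i) *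
        (harmonic (N - i) : ℝ)) + ((a + d) ^ (N + 1) - d ^ (N + 1)) / (N + 1) := by
    rw [Finset.sum_range_succ, Nat.choose_succ_self, add_comm a d, add_pow,
      Finset.sum_range_succ (n := N + 1)]
    simp only [Nat.cast_zero, zero_mul, add_zero, Nat.sub_self, pow_zero, Nat.choose_self,
      Nat.cast_one, mul_one, add_sub_cancel_right]
    rw [Finset.mul_sum, Finset.sum_div, ← Finset.sum_add_distrib]
    refine Finset.sum_congr rfl fun i hi => ?_
    have hi' : i ≤ N := by simpa [Nat.lt_succ_iff] using hi
    obtain ⟨j, rfl⟩ := Nat.exists_eq_add_of_le hi'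
    have hc := Nat.choose_mul_succ_eq (i + j) i
    rw [show i + j + 1 - i = j + 1 by omega] at hc ⊢
    rw [show i + j - i = j by omega, harmonic_succ]
    have hc' : (((i + j).choose i : ℕ) : ℝ) * (((i + j : ℕ) : ℝ) + 1) =
      ((i + j + 1).choose i : ℕ) * ((j : ℝ) + 1) := by exact_mod_cast hc
    have hj : (j : ℝ) + 1 ≠ 0 := by positivity
    push_cast at hN hc' ⊢
    field_simp
    linear_combination d ^ i * a ^ (j + 1) * hc'
  rw [add_mul, add_right_comm, ← h1, Finset.sum_range_succ', Finset.sum_range_succ' _ (N + 1),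
    Finset.mul_sum, add_right_comm, ← Finset.sum_add_distrib]
  congr 1
  · refine Finset.sum_congr rfl fun i _ => ?_
    rw [Nat.choose_succ_succ, show N + 1 - (i + 1) = N - i by omega]
    push_cast
    ring
  · simp

lemma integral_sub_pow_div_add {a d : ℝ} (h : (0 : ℝ) ∉ Set.uIcc a (a + d)) (N : ℕ) :
    ∫ x in (0 : ℝ)..d, (d - x) ^ N / (a + x) =
      (a + d) ^ N * (log ((a + d) / a) - (harmonic N : ℝ)) +
        ∑ i ∈ Finset.range (N + 1), (N.choose i : ℝ) * d ^ i * a ^ (N - i) *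
          (harmonic (N - i) : ℝ) := by
  have hne (x : ℝ) (hx : x ∈ Set.uIcc 0 d) : a + x ≠ 0 := by
    intro h0
    apply h
    rw [← h0]
    have := Set.image_const_add_uIcc a 0 d
    rw [add_zero] at this
    rw [← this]
    exact ⟨x, hx, rfl⟩
  induction N with
  | zero =>
    have := intervalIntegral.integral_comp_add_left (a := 0) (b := d) (fun x : ℝ => x⁻¹) a
    rw [add_zero, integral_inv h] at this
    simpa using this
  | succ N ih =>
    have hc : ContinuousOn (fun x : ℝ => (d - x) ^ N / (a + x)) (Set.uIcc 0 d) :=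
      ContinuousOn.div (by fun_prop) (by fun_prop) hne
    have he : ∫ x in (0 : ℝ)..d, (d - x) ^ (N + 1) / (a + x) =
        ∫ x in (0 : ℝ)..d, ((a + d) * ((d - x) ^ N / (a + x)) - (d - x) ^ N * x ^ 0) := by
      refine intervalIntegral.integral_congr fun x hx => ?_
      have := hne x hx
      field_simp
      ring
    have hp : ∫ x in (0 : ℝ)..d, (d - x) ^ N * x ^ 0 = d ^ (N + 1) / (N + 1) := by
      have := intervalIntegral.integral_comp_sub_left (a := 0) (b := d) (fun x : ℝ => x ^ N) d
      simpa using this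
    rw [he, intervalIntegral.integral_sub (hc.intervalIntegrable.const_mul _)
      (by apply Continuous.intervalIntegrable; fun_prop), intervalIntegral.integral_const_mul, ih,
      sum_choose_mul_harmonic_succ, hp, harmonic_succ]
    have hN : (N : ℝ) + 1 ≠ 0 := by positivity
    push_cast
    field_simp
    ring

lemma integral_sub_pow_succ_succ_mul_sin (c ω : ℝ) (hω : ω ≠ 0) (N : ℕ) :
    ∫ x in (0 : ℝ)..c, (c - x) ^ (N + 2) * sin (ω * x) =
      c ^ (N + 2) / ω -
        (N + 2) * (N + 1) / ω ^ 2 * ∫ x in (0 : ℝ)..c, (c - x) ^ N * sin (ω * x) := by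
  have hd (x : ℝ) (_ : x ∈ Set.uIcc 0 c) :
      HasDerivAt (fun x : ℝ => -((c - x) ^ (N + 2) * cos (ω * x)) / ω -
          (N + 2) * ((c - x) ^ (N + 1) * sin (ω * x)) / ω ^ 2)
        ((c - x) ^ (N + 2) * sin (ω * x) +
          (N + 2) * (N + 1) / ω ^ 2 * ((c - x) ^ N * sin (ω * x))) x := by
    have h1 := (hasDerivAt_id x).const_sub c
    have h2 := (hasDerivAt_id x).const_mul ω
    convert! (((h1.pow (N + 2)).mul h2.cos).neg.div_const ω).sub
      ((((h1.pow (N + 1)).mul h2.sin).const_mul ((N : ℝ) + 2)).div_const (ω ^ 2)) using 1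
    simp
    field_simp
    ring
  have h := intervalIntegral.integral_eq_sub_of_hasDerivAt hd
    (by apply Continuous.intervalIntegrable; fun_prop)
  rw [intervalIntegral.integral_add (by apply Continuous.intervalIntegrable; fun_prop)
    (by apply Continuous.intervalIntegrable; fun_prop),
    intervalIntegral.integral_const_mul] at h
  simp at h
  linear_combination h

lemma integral_sub_mul_sin (c ω : ℝ) (hω : ω ≠ 0) :
    ∫ x in (0 : ℝ)..c, (c - x) * sin (ω * x) = c / ω - sin (ω * c) / ω ^ 2 := by
  have hd (x : ℝ) (_ : x ∈ Set.uIcc 0 c) :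
      HasDerivAt (fun x : ℝ => -((c - x) * cos (ω * x)) / ω - sin (ω * x) / ω ^ 2)
        ((c - x) * sin (ω * x)) x := by
    have h1 := (hasDerivAt_id x).const_sub c
    have h2 := (hasDerivAt_id x).const_mul ω
    convert! ((h1.mul h2.cos).neg.div_const ω).sub (h2.sin.div_const (ω ^ 2)) using 1
    simp
    field_simp
    ring
  rw [intervalIntegral.integral_eq_sub_of_hasDerivAt hd
    (by apply Continuous.intervalIntegrable; fun_prop)]
  simp
  ring

lemma two_pi_mul_integral_half_sub_pow_mul_sin (n k : ℕ) :
    2 * π * ∫ x in (0 : ℝ)..1 / 2, (1 / 2 - x) ^ (2 * n + 1) * sin (2 * π * (k + 1) * x) =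
      ∑ j ∈ Finset.range (n + 1), (-1) ^ (n - j) *
        ((2 * n + 1).factorial / (2 * j + 1).factorial) * (1 / 2) ^ (2 * j + 1) /
          (2 * π) ^ (2 * (n - j)) * (1 / ((k : ℝ) + 1) ^ (2 * (n - j) + 1)) := by
  have hk : (k : ℝ) + 1 ≠ 0 := by positivity
  have hπ := pi_ne_zero
  have hω : 2 * π * ((k : ℝ) + 1) ≠ 0 := by positivity
  induction n with
  | zero =>
    have hs : sin (2 * π * ((k : ℝ) + 1) * (1 / 2)) = 0 := by
      rw [show 2 * π * ((k : ℝ) + 1) * (1 / 2) = (k + 1 : ℕ) * π by push_cast; ring]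
      exact sin_nat_mul_pi _
    simp only [mul_zero, zero_add, pow_one, integral_sub_mul_sin _ _ hω, hs]
    simp
    field_simp
  | succ n ih =>
    rw [show 2 * (n + 1) + 1 = 2 * n + 1 + 2 by ring,
      integral_sub_pow_succ_succ_mul_sin _ _ hω, mul_sub, mul_left_comm, ih, Finset.mul_sum,
      Finset.sum_range_succ _ (n + 1), sub_eq_neg_add, ← Finset.sum_neg_distrib]
    congr 1
    · refine Finset.sum_congr rfl fun j hj => ?_
      have hj' : j ≤ n := by simpa [Nat.lt_succ_iff] using hj
      obtain ⟨i, rfl⟩ := Nat.exists_eq_add_of_le hj'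
      have hf : ((2 * (j + i) + 1 + 2).factorial : ℝ) =
          (2 * (j + i) + 3) * ((2 * (j + i) + 2) * (2 * (j + i) + 1).factorial) := by
        rw [Nat.factorial_succ, Nat.factorial_succ]
        push_cast
        ring
      rw [show j + i - j = i by omega, show j + i + 1 - j = i + 1 by omega, hf]
      have := (2 * j + 1).factorial_ne_zero
      push_cast
      field_simp
      ring
    · have := (2 * n + 1 + 2).factorial_ne_zero
      have := (2 * (n + 1) + 1).factorial_ne_zero
      simp [show 2 * n + 1 + 2 = 2 * (n + 1) + 1 by ring]
      field_simp

lemma sin_pi_mul_pos {x : ℝ} (h0 : 0 < x) (h1 : x < 1) : 0 < sin (π * x) :=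
  sin_pos_of_pos_of_lt_pi (by positivity) (by nlinarith [pi_pos])

lemma sinc_pi_mul_ne_zero {x : ℝ} (h0 : 0 ≤ x) (h1 : x < 1) : sinc (π * x) ≠ 0 := by
  rcases h0.eq_or_lt with rfl | h0
  · simp
  · rw [sinc_of_ne_zero (by positivity)]
    have := sin_pi_mul_pos h0 h1
    positivity

lemma integral_log_sinc_zero_pi_div_two :
    ∫ y in (0 : ℝ)..π / 2, log (sinc y) = π / 2 * (1 - log π) := by
  have h : ∫ y in (0 : ℝ)..π / 2, log (sinc y) =
      ∫ y in (0 : ℝ)..π / 2, (log (sin y) - log y) := by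
    refine intervalIntegral.integral_congr_Ioo_of_le (by positivity) fun y hy => ?_
    have hs : 0 < sin y := sin_pos_of_pos_of_lt_pi hy.1 (by linarith [hy.2, pi_pos])
    simp only [sinc_of_ne_zero hy.1.ne']
    rw [log_div hs.ne' hy.1.ne']
  have hi : IntervalIntegrable (fun y => log (sin y)) MeasureTheory.volume 0 (π / 2) :=
    intervalIntegrable_log_sin
  rw [h, intervalIntegral.integral_sub hi
    intervalIntegral.intervalIntegrable_log', integral_log_sin_zero_pi_div_two, integral_log,
    log_div pi_ne_zero two_ne_zero]
  simp
  ring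

lemma hasDerivAt_log_sinc_pi_mul {x : ℝ} (h0 : 0 < x) (h1 : x < 1) :
    HasDerivAt (fun x : ℝ => log (sinc (π * x))) (-cotDefect x) x := by
  have hs := sin_pi_mul_pos h0 h1
  have hd : HasDerivAt (fun x : ℝ => log (sin (π * x)) - log (π * x)) (-cotDefect x) x := by
    have hl := (hasDerivAt_id x).const_mul π
    convert! (hl.sin.log hs.ne').sub (hl.log (by simp [pi_ne_zero, h0.ne'])) using 1
    simp [cotDefect]
    field_simp
  refine hd.congr_of_eventuallyEq ?_
  filter_upwards [Ioo_mem_nhds h0 h1] with y hy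
  have hy0 : π * y ≠ 0 := mul_ne_zero pi_ne_zero hy.1.ne'
  rw [sinc_of_ne_zero hy0, log_div (sin_pi_mul_pos hy.1 hy.2).ne' hy0]

lemma intervalIntegrable_mul_cotDefect {f : ℝ → ℝ} (hf : Continuous f) :
    IntervalIntegrable (fun x => f x * cotDefect x) MeasureTheory.volume 0 (1 / 2) := by
  apply ContinuousOn.intervalIntegrable
  rw [Set.uIcc_of_le (by norm_num)]
  exact hf.continuousOn.mul continuousOn_cotDefect

lemma integral_half_sub_mul_cotDefect :
    ∫ x in (0 : ℝ)..1 / 2, (1 / 2 - x) * cotDefect x = 1 / 2 * (log π - 1) := by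
  have hcont : ContinuousOn (fun x : ℝ => log (sinc (π * x))) (Set.Icc 0 (1 / 2)) :=
    ContinuousOn.log (by fun_prop) fun x hx => sinc_pi_mul_ne_zero hx.1 (by linarith [hx.2])
  have hlog : IntervalIntegrable (fun x : ℝ => log (sinc (π * x)))
      MeasureTheory.volume 0 (1 / 2) := by
    apply ContinuousOn.intervalIntegrable
    rwa [Set.uIcc_of_le (by norm_num)]
  have hneg : IntervalIntegrable (fun x : ℝ => -log (sinc (π * x)))
      MeasureTheory.volume 0 (1 / 2) := hlog.neg
  have hg := intervalIntegrable_mul_cotDefect (f := fun x => 1 / 2 - x) (by fun_prop)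
  have h := intervalIntegral.integral_eq_sub_of_hasDerivAt_of_le (a := 0) (b := 1 / 2)
    (f := fun x : ℝ => (1 / 2 - x) * log (sinc (π * x)))
    (f' := fun x : ℝ => -log (sinc (π * x)) - (1 / 2 - x) * cotDefect x) (by norm_num)
    (ContinuousOn.mul (by fun_prop) hcont)
    (fun x hx => by
      convert! ((hasDerivAt_id x).const_sub (1 / 2)).mul
        (hasDerivAt_log_sinc_pi_mul hx.1 (by linarith [hx.2])) using 1
      simp
      ring)
    (hneg.sub hg)
  rw [intervalIntegral.integral_sub hneg hg,
    intervalIntegral.integral_neg,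
    intervalIntegral.integral_comp_mul_left (fun y => log (sinc y)) pi_ne_zero, mul_zero,
    mul_one_div, integral_log_sinc_zero_pi_div_two] at h
  simp at h
  field_simp at h ⊢
  linarith

lemma sin_mul_sum_two_mul_sin (y : ℝ) (K : ℕ) :
    sin y * ∑ k ∈ Finset.range K, 2 * sin (2 * ((k : ℝ) + 1) * y) =
      cos y - cos ((2 * K + 1) * y) := by
  induction K with
  | zero => simp
  | succ K ih =>
    rw [Finset.sum_range_succ, mul_add, ih]
    have h1 : cos ((2 * (K : ℝ) + 1) * y) =
        cos (2 * ((K : ℝ) + 1) * y) * cos y + sin (2 * ((K : ℝ) + 1) * y) * sin y := by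
      rw [← cos_sub]; ring_nf
    have h2 : cos ((2 * ((K + 1 : ℕ) : ℝ) + 1) * y) =
        cos (2 * ((K : ℝ) + 1) * y) * cos y - sin (2 * ((K : ℝ) + 1) * y) * sin y := by
      rw [← cos_add]; push_cast; ring_nf
    rw [h1, h2]
    ring

open Filter Topology in
lemma tendsto_integral_mul_cos {f : ℝ → ℝ} {a b : ℝ} (hab : a ≤ b)
    (hf : IntervalIntegrable f MeasureTheory.volume a b) :
    Tendsto (fun K : ℕ => ∫ x in a..b, f x * cos ((2 * K + 1) * (π * x))) atTop (𝓝 0) := by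
  have hw : Tendsto (fun K : ℕ => (K : ℝ) + 1 / 2) atTop (cocompact ℝ) :=
    (tendsto_atTop_add_const_right _ _ tendsto_natCast_atTop_atTop).mono_right atTop_le_cocompact
  have h := ((Complex.continuous_re.tendsto 0).comp
    ((Real.tendsto_integral_exp_smul_cocompact
      ((Set.Ioc a b).indicator fun x => (f x : ℂ))).comp hw))
  refine h.congr fun K => ?_
  have he (x : ℝ) : Real.fourierChar (-(x * ((K : ℝ) + 1 / 2))) •
      (Set.Ioc a b).indicator (fun x => (f x : ℂ)) x = (Set.Ioc a b).indicator
        (fun x => (Real.fourierChar (-(x * ((K : ℝ) + 1 / 2)))) • (f x : ℂ)) x := by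
    by_cases hx : x ∈ Set.Ioc a b <;> simp [hx]
  simp only [Function.comp_apply, he]
  rw [MeasureTheory.integral_indicator measurableSet_Ioc, intervalIntegral.integral_of_le hab]
  have hi : MeasureTheory.IntegrableOn
      (fun x => (Real.fourierChar (-(x * ((K : ℝ) + 1 / 2)))) • (f x : ℂ)) (Set.Ioc a b) := by
    have := ((intervalIntegrable_iff_integrableOn_Ioc_of_le hab).1 hf).ofReal (𝕜 := ℂ)
    refine this.bdd_smul 1 ?_ (Eventually.of_forall fun x => (Circle.norm_coe _).le)
    exact Continuous.aestronglyMeasurable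
      (continuous_subtype_val.comp (Real.continuous_fourierChar.comp (by fun_prop)))
  have := integral_re hi
  simp only [RCLike.re_to_complex] at this
  rw [← this]
  congr 1
  ext x
  rw [Circle.smul_def, Real.fourierChar_apply, smul_eq_mul, Complex.re_mul_ofReal]
  rw [Complex.exp_ofReal_mul_I_re, mul_comm, ← cos_neg]
  ring_nf

open Filter Topology in
lemma tendsto_sum_integral_mul_sin {Q : ℝ → ℝ} (hQ : Continuous Q) :
    Tendsto (fun K : ℕ => ∑ k ∈ Finset.range K,
      2 * π * ∫ x in (0 : ℝ)..1 / 2, x * Q x * sin (2 * π * ((k : ℝ) + 1) * x)) atTop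
      (𝓝 ((∫ x in (0 : ℝ)..1 / 2, Q x) - ∫ x in (0 : ℝ)..1 / 2, x * Q x * cotDefect x)) := by
  have hF : IntervalIntegrable (fun x => Q x / sinc (π * x)) MeasureTheory.volume 0 (1 / 2) := by
    apply ContinuousOn.intervalIntegrable
    rw [Set.uIcc_of_le (by norm_num)]
    exact hQ.continuousOn.div (by fun_prop)
      fun x hx => sinc_pi_mul_ne_zero hx.1 (by linarith [hx.2])
  have hg := intervalIntegrable_mul_cotDefect (f := fun x => x * Q x) (by fun_prop)
  have hQi : IntervalIntegrable Q MeasureTheory.volume 0 (1 / 2) := hQ.intervalIntegrable _ _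
  have ht := (tendsto_integral_mul_cos (by norm_num) hF).const_sub
    ((∫ x in (0 : ℝ)..1 / 2, Q x) - ∫ x in (0 : ℝ)..1 / 2, x * Q x * cotDefect x)
  rw [sub_zero] at ht
  refine ht.congr fun K => ?_
  have hc : IntervalIntegrable (fun x => Q x / sinc (π * x) * cos ((2 * (K : ℝ) + 1) * (π * x)))
      MeasureTheory.volume 0 (1 / 2) := hF.mul_continuousOn (by fun_prop)
  rw [← intervalIntegral.integral_sub hQi hg, ← intervalIntegral.integral_sub (hQi.sub hg) hc]
  simp_rw [← intervalIntegral.integral_const_mul]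
  rw [← intervalIntegral.integral_finsetSum fun k _ =>
    Continuous.intervalIntegrable (by fun_prop) _ _]
  refine intervalIntegral.integral_congr_Ioo_of_le (by norm_num) fun x hx => ?_
  have hs : sin (π * x) ≠ 0 := (sin_pi_mul_pos hx.1 (by linarith [hx.2])).ne'
  have hx0 : x ≠ 0 := hx.1.ne'
  have hd := sin_mul_sum_two_mul_sin (π * x) K
  have he : ∑ k ∈ Finset.range K, 2 * π * (x * Q x * sin (2 * π * ((k : ℝ) + 1) * x)) =
      π * x * Q x * ∑ k ∈ Finset.range K, 2 * sin (2 * ((k : ℝ) + 1) * (π * x)) := by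
    rw [Finset.mul_sum]
    refine Finset.sum_congr rfl fun k _ => ?_
    rw [show 2 * π * ((k : ℝ) + 1) * x = 2 * ((k : ℝ) + 1) * (π * x) by ring]
    ring
  simp only [he]
  rw [eq_div_of_mul_eq hs ((mul_comm _ _).trans hd), sinc_of_ne_zero (by positivity), cotDefect]
  field_simp
  ring

/-- The quotient `((1/2 - x) ^ (m + 1) - (1/2) ^ m * (1/2 - x)) / x`, as a polynomial. -/
noncomputable def halfSubQuotient : ℕ → ℝ → ℝ
  | 0, _ => 0
  | m + 1, x => 1 / 2 * halfSubQuotient m x - (1 / 2 - x) ^ (m + 1)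

lemma continuous_halfSubQuotient (m : ℕ) : Continuous (halfSubQuotient m) := by
  induction m with
  | zero => exact continuous_const
  | succ m ih =>
    have : halfSubQuotient (m + 1) =
      fun x => 1 / 2 * halfSubQuotient m x - (1 / 2 - x) ^ (m + 1) := rfl
    rw [this]
    fun_prop

lemma mul_halfSubQuotient (m : ℕ) (x : ℝ) :
    x * halfSubQuotient m x = (1 / 2 - x) ^ (m + 1) - (1 / 2) ^ m * (1 / 2 - x) := by
  induction m with
  | zero => simp [halfSubQuotient]
  | succ m ih =>
    simp only [halfSubQuotient]
    linear_combination 1 / 2 * ih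

lemma integral_halfSubQuotient (m : ℕ) :
    ∫ x in (0 : ℝ)..1 / 2, halfSubQuotient m x =
      -((1 / 2) ^ (m + 1) * ((harmonic (m + 1) : ℝ) - 1)) := by
  induction m with
  | zero => simp [halfSubQuotient]
  | succ m ih =>
    simp only [halfSubQuotient]
    rw [intervalIntegral.integral_sub
      (Continuous.intervalIntegrable (by have := continuous_halfSubQuotient m; fun_prop) _ _)
      (Continuous.intervalIntegrable (by fun_prop) _ _), intervalIntegral.integral_const_mul, ih]
    have := integral_sub_pow_mul_pow (1 / 2) (m + 1) 0
    simp only [pow_zero, mul_one, add_zero, Nat.factorial_zero, Nat.cast_one] at this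
    rw [this, harmonic_succ (m + 1), Nat.factorial_succ (m + 1)]
    push_cast
    have : ((m + 1).factorial : ℝ) ≠ 0 := by positivity
    field_simp
    ring

lemma two_pi_mul_integral_mul_halfSubQuotient_mul_sin (n k : ℕ) :
    2 * π * ∫ x in (0 : ℝ)..1 / 2, x * halfSubQuotient (2 * n) x * sin (2 * π * ((k : ℝ) + 1) * x) =
      ∑ j ∈ Finset.range n, (-1) ^ (n - j) * ((2 * n + 1).factorial / (2 * j + 1).factorial) *
        (1 / 2) ^ (2 * j + 1) / (2 * π) ^ (2 * (n - j)) *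
          (1 / ((k : ℝ) + 1) ^ (2 * (n - j) + 1)) := by
  have h1 := two_pi_mul_integral_half_sub_pow_mul_sin n k
  have h0 := two_pi_mul_integral_half_sub_pow_mul_sin 0 k
  have hN : ((2 * n + 1).factorial : ℝ) ≠ 0 := by positivity
  rw [Finset.sum_range_succ] at h1
  simp at h0
  have he : ∫ x in (0 : ℝ)..1 / 2,
        x * halfSubQuotient (2 * n) x * sin (2 * π * ((k : ℝ) + 1) * x) =
      (∫ x in (0 : ℝ)..1 / 2, (1 / 2 - x) ^ (2 * n + 1) * sin (2 * π * ((k : ℝ) + 1) * x)) -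
        (1 / 2) ^ (2 * n) * ∫ x in (0 : ℝ)..1 / 2, (1 / 2 - x) * sin (2 * π * ((k : ℝ) + 1) * x) := by
    rw [← intervalIntegral.integral_const_mul, ← intervalIntegral.integral_sub
      (Continuous.intervalIntegrable (by fun_prop) _ _)
      (Continuous.intervalIntegrable (by fun_prop) _ _)]
    congr 1
    ext x
    rw [mul_halfSubQuotient]
    ring
  rw [he, mul_sub, h1]
  simp only [one_div] at h0 ⊢
  rw [mul_left_comm (2 * π), h0]
  simp [hN]
  ring

lemma integral_half_sub_pow_mul_cotDefect (n : ℕ) :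
    ∫ x in (0 : ℝ)..1 / 2, (1 / 2 - x) ^ (2 * n + 1) * cotDefect x =
      (1 / 2) ^ (2 * n + 1) * (log π - (harmonic (2 * n + 1) : ℝ)) -
        ∑ j ∈ Finset.range n, (-1) ^ (n - j) * ((2 * n + 1).factorial / (2 * j + 1).factorial) *
          (1 / 2) ^ (2 * j + 1) / (2 * π) ^ (2 * (n - j)) * zetaNat (2 * (n - j) + 1) := by
  have hQ := continuous_halfSubQuotient (2 * n)
  have hlim := tendsto_sum_integral_mul_sin hQ
  simp only [two_pi_mul_integral_mul_halfSubQuotient_mul_sin] at hlim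
  have hsum := (hasSum_sum fun j (hj : j ∈ Finset.range n) =>
    (hasSum_zetaNat (s := 2 * (n - j) + 1)
      (by have := Finset.mem_range.1 hj; omega)).mul_left
      ((-1) ^ (n - j) * ((2 * n + 1).factorial / (2 * j + 1).factorial) *
        (1 / 2) ^ (2 * j + 1) / (2 * π) ^ (2 * (n - j)))).tendsto_sum_nat
  have heq := tendsto_nhds_unique hlim hsum
  rw [integral_halfSubQuotient] at heq
  have he : ∫ x in (0 : ℝ)..1 / 2, (1 / 2 - x) ^ (2 * n + 1) * cotDefect x =
      (∫ x in (0 : ℝ)..1 / 2, x * halfSubQuotient (2 * n) x * cotDefect x) +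
        (1 / 2) ^ (2 * n) * ∫ x in (0 : ℝ)..1 / 2, (1 / 2 - x) * cotDefect x := by
    rw [← intervalIntegral.integral_const_mul, ← intervalIntegral.integral_add
      (intervalIntegrable_mul_cotDefect (f := fun x => x * halfSubQuotient (2 * n) x) (by fun_prop))
      ((intervalIntegrable_mul_cotDefect (f := fun x => 1 / 2 - x) (by fun_prop)).const_mul _)]
    congr 1
    ext x
    rw [mul_halfSubQuotient]
    ring
  rw [he, integral_half_sub_mul_cotDefect]
  linear_combination -heq

lemma hasSum_integral_zetaNat_sub_one (N : ℕ) :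
    HasSum (fun l : ℕ => 2 * (zetaNat (2 * l + 2) - 1) * ((1 / 2) ^ (N + (2 * l + 1) + 1) *
        (N.factorial * (2 * l + 1).factorial / (N + (2 * l + 1) + 1).factorial)))
      (∫ x in (0 : ℝ)..1 / 2, (1 / 2 - x) ^ N * (cotDefect x - 2 * x / (1 - x ^ 2))) := by
  have key {x : ℝ} (h0 : 0 ≤ x) (h1 : x < 1) :
      HasSum (fun l : ℕ => 2 * (zetaNat (2 * l + 2) - 1) * x ^ (2 * l + 1))
        (cotDefect x - 2 * x / (1 - x ^ 2)) := by
    have hg := (hasSum_geometric_of_lt_one (sq_nonneg x) (by nlinarith)).mul_left (2 * x)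
    convert! (hasSum_cotDefect h0 h1).sub hg using 1
    ext l
    ring
  have hz (l : ℕ) : 0 ≤ 2 * (zetaNat (2 * l + 2) - 1) := by
    have := one_le_zetaNat (s := 2 * l + 2) (by omega)
    linarith
  have h := intervalIntegral.hasSum_integral_of_dominated_convergence (μ := MeasureTheory.volume)
    (a := 0) (b := 1 / 2)
    (F := fun l x => (1 / 2 - x) ^ N * (2 * (zetaNat (2 * l + 2) - 1) * x ^ (2 * l + 1)))
    (f := fun x => (1 / 2 - x) ^ N * (cotDefect x - 2 * x / (1 - x ^ 2)))
    (fun l _ => 2 * (zetaNat (2 * l + 2) - 1) * (1 / 2) ^ (2 * l + 1))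
    (fun l => Continuous.aestronglyMeasurable (by fun_prop))
    (fun l => Filter.Eventually.of_forall fun x hx => ?_)
    (Filter.Eventually.of_forall fun x hx => (key (by norm_num) (by norm_num)).summable)
    (by simp)
    (Filter.Eventually.of_forall fun x hx => ?_)
  · convert! h using 1
    ext l
    rw [← integral_sub_pow_mul_pow, ← intervalIntegral.integral_const_mul]
    congr 1
    ext x
    ring
  · rw [Set.uIoc_of_le (by norm_num)] at hx
    have hp : (1 / 2 - x) ^ N ≤ 1 :=
      pow_le_one₀ (by linarith [hx.2]) (by linarith [hx.1])
    have hp0 : 0 ≤ (1 / 2 - x) ^ N := pow_nonneg (by linarith [hx.2]) _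
    have hx2 : x ^ (2 * l + 1) ≤ (1 / 2) ^ (2 * l + 1) :=
      pow_le_pow_left₀ hx.1.le hx.2 _
    have hx0 : 0 ≤ x ^ (2 * l + 1) := pow_nonneg hx.1.le _
    rw [Real.norm_of_nonneg (mul_nonneg hp0 (mul_nonneg (hz l) hx0))]
    exact (mul_le_of_le_one_left (mul_nonneg (hz l) hx0) hp).trans
      (mul_le_mul_of_nonneg_left hx2 (hz l))
  · rw [Set.uIoc_of_le (by norm_num)] at hx
    exact (key hx.1.le (by linarith [hx.2])).mul_left _

lemma sum_range_two_mul {M : Type*} [AddCommMonoid M] (f : ℕ → M) (m : ℕ) :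
    ∑ i ∈ Finset.range (2 * m), f i = ∑ k ∈ Finset.range m, (f (2 * k) + f (2 * k + 1)) := by
  induction m with
  | zero => simp
  | succ m ih =>
    rw [show 2 * (m + 1) = 2 * m + 1 + 1 by ring, Finset.sum_range_succ, Finset.sum_range_succ, ih,
      Finset.sum_range_succ, add_assoc]

lemma two_mul_sum_choose_odd_mul_quarter_pow (n : ℕ) :
    ∑ k ∈ Finset.range (n + 1), ((2 * n + 1).choose (2 * k + 1) : ℝ) * (1 / 4) ^ k =
      (3 / 2) ^ (2 * n + 1) - (1 / 2) ^ (2 * n + 1) := by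
  have h1 := add_pow (1 / 2 : ℝ) 1 (2 * n + 1)
  have h2 := add_pow (-(1 / 2) : ℝ) 1 (2 * n + 1)
  rw [show 2 * n + 1 + 1 = 2 * (n + 1) by ring, sum_range_two_mul] at h1 h2
  rw [show (3 / 2 : ℝ) = 1 / 2 + 1 by norm_num, h1]
  rw [show (-(1 / 2) : ℝ) + 1 = 1 / 2 by norm_num] at h2
  rw [h2, ← Finset.sum_sub_distrib]
  refine Finset.sum_congr rfl fun k _ => ?_
  rw [Even.neg_pow (even_two_mul k), Odd.neg_pow ⟨k, rfl⟩, pow_succ (1 / 2 : ℝ) (2 * k),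
    pow_mul (1 / 2 : ℝ) 2 k]
  norm_num
  ring

lemma integral_half_sub_pow_mul_partialFraction (n : ℕ) :
    ∫ x in (0 : ℝ)..1 / 2, (1 / 2 - x) ^ (2 * n + 1) * (2 * x / (1 - x ^ 2)) =
      -((3 / 2) ^ (2 * n + 1) * (log (3 / 2) - (harmonic (2 * n + 1) : ℝ)) +
        (1 / 2) ^ (2 * n + 1) * (log 2 + (harmonic (2 * n + 1) : ℝ)) +
        ∑ k ∈ Finset.range (n + 1), ((2 * n + 1).choose (2 * k + 1) : ℝ) * (1 / 4) ^ k *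
          (harmonic (2 * n - 2 * k) : ℝ)) := by
  have h1 := integral_sub_pow_div_add (a := 1) (d := 1 / 2)
    (by rw [Set.uIcc_of_le (by norm_num)]; norm_num) (2 * n + 1)
  have h2 := integral_sub_pow_div_add (a := -1) (d := 1 / 2)
    (by rw [Set.uIcc_of_le (by norm_num)]; norm_num) (2 * n + 1)
  have hi {a : ℝ} (ha : ∀ x ∈ Set.Icc (0 : ℝ) (1 / 2), a + x ≠ 0) :
      IntervalIntegrable (fun x => (1 / 2 - x) ^ (2 * n + 1) / (a + x))
        MeasureTheory.volume 0 (1 / 2) := by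
    apply ContinuousOn.intervalIntegrable
    rw [Set.uIcc_of_le (by norm_num)]
    exact ContinuousOn.div (by fun_prop) (by fun_prop) ha
  have he : ∫ x in (0 : ℝ)..1 / 2, (1 / 2 - x) ^ (2 * n + 1) * (2 * x / (1 - x ^ 2)) =
      -((∫ x in (0 : ℝ)..1 / 2, (1 / 2 - x) ^ (2 * n + 1) / (1 + x)) +
        ∫ x in (0 : ℝ)..1 / 2, (1 / 2 - x) ^ (2 * n + 1) / (-1 + x)) := by
    rw [← intervalIntegral.integral_add (hi fun x hx => by linarith [hx.1])
      (hi fun x hx => by linarith [hx.2]), ← intervalIntegral.integral_neg]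
    refine intervalIntegral.integral_congr fun x hx => ?_
    rw [Set.uIcc_of_le (by norm_num)] at hx
    have hx1 : 1 + x ≠ 0 := by linarith [hx.1]
    have hx2 : -1 + x ≠ 0 := by linarith [hx.2]
    have hx3 : 1 - x ^ 2 ≠ 0 := by nlinarith [hx.1, hx.2]
    field_simp
    ring
  have hs : (∑ i ∈ Finset.range (2 * n + 1 + 1), ((2 * n + 1).choose i : ℝ) * (1 / 2) ^ i *
        1 ^ (2 * n + 1 - i) * (harmonic (2 * n + 1 - i) : ℝ)) +
      (∑ i ∈ Finset.range (2 * n + 1 + 1), ((2 * n + 1).choose i : ℝ) * (1 / 2) ^ i *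
        (-1) ^ (2 * n + 1 - i) * (harmonic (2 * n + 1 - i) : ℝ)) =
      ∑ k ∈ Finset.range (n + 1), ((2 * n + 1).choose (2 * k + 1) : ℝ) * (1 / 4) ^ k *
          (harmonic (2 * n - 2 * k) : ℝ) := by
    rw [show 2 * n + 1 + 1 = 2 * (n + 1) by ring, sum_range_two_mul, sum_range_two_mul,
      ← Finset.sum_add_distrib]
    refine Finset.sum_congr rfl fun k hk => ?_
    have hk' : k ≤ n := by have := Finset.mem_range.1 hk; omega
    rw [show 2 * n + 1 - 2 * k = 2 * (n - k) + 1 by omega,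
      show 2 * n + 1 - (2 * k + 1) = 2 * (n - k) by omega,
      show 2 * n - 2 * k = 2 * (n - k) by omega, Odd.neg_one_pow ⟨n - k, rfl⟩,
      Even.neg_one_pow (even_two_mul _), pow_succ (1 / 2 : ℝ) (2 * k), pow_mul (1 / 2 : ℝ) 2 k]
    norm_num
    ring
  rw [he, h1, h2, ← hs]
  have hN : (-1 + 1 / 2 : ℝ) ^ (2 * n + 1) = -(1 / 2) ^ (2 * n + 1) := by
    rw [← Odd.neg_pow ⟨n, rfl⟩]; norm_num
  rw [hN, show (-1 + 1 / 2 : ℝ) / -1 = 2⁻¹ by norm_num, log_inv]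
  norm_num
  ring

lemma deriv_riemannZeta_neg_two_mul {m : ℕ} (hm : 1 ≤ m) :
    deriv riemannZeta (-(2 * (m : ℂ))) =
      (((-1) ^ m * (2 * m).factorial / (2 * (2 * π) ^ (2 * m)) * zetaNat (2 * m + 1) : ℝ) : ℂ) := by
  set s : ℂ := 2 * (m : ℂ) + 1 with hs
  have hsN : ((2 * m + 1 : ℕ) : ℂ) = s := by push_cast; rfl
  have hs1 : s ≠ 1 := by
    rw [← hsN]
    exact_mod_cast show 2 * m + 1 ≠ 1 by omega
  have hsneg (k : ℕ) : s ≠ -k := by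
    intro h
    have : ((2 * m + 1 + k : ℕ) : ℂ) = 0 := by
      rw [Nat.cast_add, hsN, h]; ring
    norm_cast at this
    omega
  have hcos : Complex.cos (π * s / 2) = 0 := by
    rw [Complex.cos_eq_zero_iff]
    exact ⟨m, by rw [hs]; push_cast; ring⟩
  have hsin : Complex.sin (π * s / 2) = (-1) ^ m := by
    rw [hs, show (π : ℂ) * (2 * m + 1) / 2 = π / 2 + m * π by ring, add_comm, Complex.sin_add_pi_div_two]
    exact_mod_cast congrArg Complex.ofReal (Real.cos_nat_mul_pi m)
  have hpi : (2 * (π : ℂ)) ≠ 0 := by simp [pi_ne_zero]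
  have hG : DifferentiableAt ℂ (fun z : ℂ => 2 * (2 * π) ^ (-z) * Complex.Gamma z) s := by
    have := Complex.differentiableAt_Gamma s hsneg
    have h2 : DifferentiableAt ℂ (fun z : ℂ => (2 * (π : ℂ)) ^ (-z)) s :=
      differentiableAt_id.neg.const_cpow (Or.inl hpi)
    fun_prop
  have hC : HasDerivAt (fun z : ℂ => Complex.cos (π * z / 2))
      (-Complex.sin (π * s / 2) * (π / 2)) s := by
    have := (((hasDerivAt_id s).const_mul (π : ℂ)).div_const 2).ccos
    simpa using this
  have hR := ((hG.hasDerivAt.mul hC).mul (differentiableAt_riemannZeta hs1).hasDerivAt)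
  have hz : HasDerivAt riemannZeta (deriv riemannZeta (1 - s)) (1 - s) := by
    apply DifferentiableAt.hasDerivAt
    apply differentiableAt_riemannZeta
    intro h
    exact hsneg 0 (by simpa using h)
  have hL := hz.comp s ((hasDerivAt_id s).const_sub 1)
  have hev : (riemannZeta ∘ fun z => 1 - z) =ᶠ[nhds s]
      fun z => 2 * (2 * π) ^ (-z) * Complex.Gamma z * Complex.cos (π * z / 2) * riemannZeta z := by
    have hopen : ∀ᶠ z in nhds s, 0 < z.re := by
      refine (Complex.continuous_re.tendsto s).eventually (lt_mem_nhds ?_)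
      rw [← hsN, Complex.natCast_re]
      positivity
    filter_upwards [hopen, isOpen_ne.mem_nhds hs1] with z hz0 hz1
    refine riemannZeta_one_sub (fun k hk => ?_) hz1
    rw [show z = -(k : ℂ) from hk] at hz0
    simp at hz0
    linarith [Nat.cast_nonneg (α := ℝ) k]
  have heq := (hL.congr_of_eventuallyEq hev.symm).unique hR
  simp only [Pi.mul_apply, hcos, hsin] at heq
  rw [show -(2 * (m : ℂ)) = 1 - s by rw [hs]; ring]
  have hzs : riemannZeta s = (zetaNat (2 * m + 1) : ℂ) := by
    rw [← hsN]
    exact riemannZeta_eq_zetaNat (by omega)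
  have hGs : Complex.Gamma s = (2 * m).factorial := by
    rw [hs]
    exact_mod_cast Complex.Gamma_nat_eq_factorial (2 * m)
  have hpow : (2 * (π : ℂ)) ^ (-s) = ((2 * (π : ℂ)) ^ (2 * m + 1))⁻¹ := by
    rw [Complex.cpow_neg, ← hsN, Complex.cpow_natCast]
  rw [hzs, hGs, hpow, mul_zero, mul_zero, zero_add, zero_mul, add_zero] at heq
  clear hR hL hev hG hC hz
  have hpi' : (π : ℂ) ≠ 0 := by simp [pi_ne_zero]
  push_cast
  rw [pow_succ] at heq
  field_simp at heq ⊢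
  linear_combination -heq

lemma sum_range_one_div_sub (M : ℕ) {m : ℕ} (hm : m ≤ M) :
    ∑ r ∈ Finset.range m, 1 / ((M : ℝ) - r) = (harmonic M : ℝ) - (harmonic (M - m) : ℝ) := by
  induction m with
  | zero => simp
  | succ m ih =>
    rw [Finset.sum_range_succ, ih (by omega), show M - m = M - (m + 1) + 1 by omega, harmonic_succ]
    have : ((M - (m + 1) + 1 : ℕ) : ℝ) = M - m := by
      rw [show M - (m + 1) + 1 = M - m by omega, Nat.cast_sub (by omega)]
    push_cast at this ⊢
    rw [this, one_div]
    ring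

lemma A_eq_harmonic_sub {n k : ℕ} (hk : k ≤ n) :
    A n k = (harmonic (2 * n) : ℝ) - (harmonic (2 * n - 2 * k) : ℝ) := by
  rw [← sum_range_one_div_sub _ (by omega : 2 * k ≤ 2 * n)]
  simp [A]

lemma factorial_mul_prod_range_add (a M : ℕ) :
    (a.factorial : ℝ) * ∏ r ∈ Finset.range M, ((a : ℝ) + 1 + r) = (a + M).factorial := by
  induction M with
  | zero => simp
  | succ M ih =>
    rw [Finset.prod_range_succ, ← mul_assoc, ih, ← add_assoc, Nat.factorial_succ]
    push_cast
    ring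

/-- The values `ζ'(-2m)` for `m ≥ 1`, in terms of `ζ(2m + 1)`. -/
noncomputable def derivZetaNegEven (m : ℕ) : ℝ :=
  (-1) ^ m * (2 * m).factorial / (2 * (2 * π) ^ (2 * m)) * zetaNat (2 * m + 1)

/-- The series `∑ (ζ(2l) - 1) / (2 ^ (2l) * ∏_{r ≤ 2n + 1} (2l + r))` over `l ≥ 1`. -/
noncomputable def zetaSubOneSeries (n : ℕ) : ℝ :=
  ∑' l : ℕ, (zetaNat (2 * (l + 1)) - 1) / (2 ^ (2 * (l + 1)) *
    ∏ r ∈ Finset.range (2 * n + 2), (2 * ((l : ℝ) + 1) + (r : ℝ)))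

lemma zetaSubOneSeries_eq_integral (n : ℕ) :
    (1 / 2) ^ (2 * n) * (2 * n + 1).factorial * zetaSubOneSeries n =
      ∫ x in (0 : ℝ)..1 / 2, (1 / 2 - x) ^ (2 * n + 1) * (cotDefect x - 2 * x / (1 - x ^ 2)) := by
  rw [← (hasSum_integral_zetaNat_sub_one (2 * n + 1)).tsum_eq, zetaSubOneSeries, ← tsum_mul_left]
  congr 1
  ext l
  have h := factorial_mul_prod_range_add (2 * l + 1) (2 * n + 2)
  rw [show 2 * n + 1 + (2 * l + 1) + 1 = 2 * l + 1 + (2 * n + 2) by ring, ← h]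
  have hp : ∏ r ∈ Finset.range (2 * n + 2), (2 * ((l : ℝ) + 1) + (r : ℝ)) =
      ∏ r ∈ Finset.range (2 * n + 2), (((2 * l + 1 : ℕ) : ℝ) + 1 + r) := by
    refine Finset.prod_congr rfl fun r _ => ?_
    push_cast
    ring
  have hpos : 0 < ∏ r ∈ Finset.range (2 * n + 2), (((2 * l + 1 : ℕ) : ℝ) + 1 + r) :=
    Finset.prod_pos fun r _ => by positivity
  rw [hp, show 2 * (l + 1) = 2 * l + 2 by ring]
  generalize ∏ r ∈ Finset.range (2 * n + 2), (((2 * l + 1 : ℕ) : ℝ) + 1 + r) = P at hpos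
  have hf : ((2 * l + 1).factorial : ℝ) ≠ 0 := by positivity
  simp only [one_div, inv_pow]
  field_simp
  ring

lemma zetaSubOneSeries_eq (n : ℕ) :
    (1 / 2) ^ (2 * n) * (2 * n + 1).factorial * zetaSubOneSeries n =
      (3 / 2) ^ (2 * n + 1) * (log (3 / 2) - (harmonic (2 * n + 1) : ℝ)) +
        (1 / 2) ^ (2 * n + 1) * log (2 * π) +
        ∑ k ∈ Finset.range (n + 1), ((2 * n + 1).choose (2 * k + 1) : ℝ) * (1 / 4) ^ k *
          (harmonic (2 * n - 2 * k) : ℝ) -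
        ∑ k ∈ Finset.range n, ((2 * n + 1).choose (2 * k + 1) : ℝ) * (1 / 4) ^ k *
          derivZetaNegEven (n - k) := by
  have hs : ∑ k ∈ Finset.range n, ((2 * n + 1).choose (2 * k + 1) : ℝ) * (1 / 4) ^ k *
        derivZetaNegEven (n - k) =
      ∑ j ∈ Finset.range n, (-1) ^ (n - j) * ((2 * n + 1).factorial / (2 * j + 1).factorial) *
          (1 / 2) ^ (2 * j + 1) / (2 * π) ^ (2 * (n - j)) * zetaNat (2 * (n - j) + 1) := by
    refine Finset.sum_congr rfl fun k hk => ?_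
    have hk' : k < n := Finset.mem_range.1 hk
    rw [Nat.cast_choose ℝ (by omega : 2 * k + 1 ≤ 2 * n + 1), derivZetaNegEven,
      show 2 * n + 1 - (2 * k + 1) = 2 * (n - k) by omega, pow_succ (1 / 2 : ℝ) (2 * k),
      pow_mul (1 / 2 : ℝ) 2 k, show (1 / 2 : ℝ) ^ 2 = 1 / 4 by norm_num]
    have h1 : ((2 * k + 1).factorial : ℝ) ≠ 0 := by positivity
    have h2 : ((2 * (n - k)).factorial : ℝ) ≠ 0 := by positivity
    have h3 : (π : ℝ) ≠ 0 := pi_ne_zero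
    field_simp
  have hg : IntervalIntegrable (fun x : ℝ => (1 / 2 - x) ^ (2 * n + 1) * (2 * x / (1 - x ^ 2)))
      MeasureTheory.volume 0 (1 / 2) := by
    apply ContinuousOn.intervalIntegrable
    rw [Set.uIcc_of_le (by norm_num)]
    refine ContinuousOn.mul (by fun_prop) (ContinuousOn.div (by fun_prop) (by fun_prop) ?_)
    intro x hx
    nlinarith [hx.1, hx.2]
  rw [zetaSubOneSeries_eq_integral, hs]
  simp_rw [mul_sub]
  rw [intervalIntegral.integral_sub (intervalIntegrable_mul_cotDefect (by fun_prop)) hg,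
    integral_half_sub_pow_mul_cotDefect, integral_half_sub_pow_mul_partialFraction,
    log_mul two_ne_zero pi_ne_zero]
  ring

lemma derivZetaNegEven_eq {n : ℕ} (hn : 1 ≤ n) :
    derivZetaNegEven n / (2 * n).factorial =
      (1 / (2 * n + 1).factorial) * (3 / 2) ^ (2 * n + 1) * (log (3 / 2) - 1 / (2 * (n : ℝ) + 1)) -
        (∑ k ∈ Finset.Icc 1 (n - 1), (A n k + derivZetaNegEven (n - k)) /
          ((2 * n - 2 * k).factorial * (2 * k + 1).factorial * 2 ^ (2 * k))) -
        (3 * A n n - log (2 * π)) / ((2 * n + 1).factorial * 2 ^ (2 * n + 1)) -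
        (1 / 2 ^ (2 * n)) * zetaSubOneSeries n := by
  have hS := zetaSubOneSeries_eq n
  have hC := two_mul_sum_choose_odd_mul_quarter_pow n
  obtain ⟨p, rfl⟩ : ∃ p, n = p + 1 := ⟨n - 1, by omega⟩
  have hsplit (f : ℕ → ℝ) :
      ∑ k ∈ Finset.range (p + 1), f k = f 0 + ∑ k ∈ Finset.Icc 1 p, f k := by
    rw [Finset.range_eq_Ico, Finset.sum_eq_sum_Ico_succ_bot (by omega)]
    rfl
  rw [Finset.sum_range_succ, hsplit] at hC
  rw [Finset.sum_range_succ _ (p + 1), hsplit, hsplit] at hS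
  have hN : ((2 * (p + 1) + 1).factorial : ℝ) ≠ 0 := by positivity
  have hsum : ∑ k ∈ Finset.Icc 1 p, (A (p + 1) k + derivZetaNegEven (p + 1 - k)) /
        ((2 * (p + 1) - 2 * k).factorial * (2 * k + 1).factorial * 2 ^ (2 * k)) =
      ((harmonic (2 * (p + 1)) : ℝ) *
        (∑ k ∈ Finset.Icc 1 p, ((2 * (p + 1) + 1).choose (2 * k + 1) : ℝ) * (1 / 4) ^ k) -
        (∑ k ∈ Finset.Icc 1 p, ((2 * (p + 1) + 1).choose (2 * k + 1) : ℝ) * (1 / 4) ^ k *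
          (harmonic (2 * (p + 1) - 2 * k) : ℝ)) +
        ∑ k ∈ Finset.Icc 1 p, ((2 * (p + 1) + 1).choose (2 * k + 1) : ℝ) * (1 / 4) ^ k *
          derivZetaNegEven (p + 1 - k)) / (2 * (p + 1) + 1).factorial := by
    rw [Finset.mul_sum, ← Finset.sum_sub_distrib, ← Finset.sum_add_distrib, Finset.sum_div]
    refine Finset.sum_congr rfl fun k hk => ?_
    have hk' : k ≤ p := (Finset.mem_Icc.1 hk).2
    rw [A_eq_harmonic_sub (by omega), Nat.cast_choose ℝ (by omega),
      show 2 * (p + 1) + 1 - (2 * k + 1) = 2 * (p + 1) - 2 * k by omega,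
      show (1 / 4 : ℝ) ^ k = 1 / 2 ^ (2 * k) by rw [pow_mul, ← one_div_pow]; norm_num]
    have h1 : ((2 * k + 1).factorial : ℝ) ≠ 0 := by positivity
    have h2 : ((2 * (p + 1) - 2 * k).factorial : ℝ) ≠ 0 := by positivity
    field_simp
  rw [show p + 1 - 1 = p by omega, hsum, A_eq_harmonic_sub le_rfl]
  rw [harmonic_succ (2 * (p + 1))] at hS
  simp only [Nat.sub_self, harmonic_zero, Rat.cast_zero, Nat.choose_self, mul_zero, zero_add,
    Nat.choose_one_right, pow_zero, Nat.sub_zero] at hS hC ⊢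
  rw [show (1 / 4 : ℝ) ^ (p + 1) = (1 / 2) ^ (2 * (p + 1)) by rw [pow_mul]; norm_num] at hC
  have hf : ((2 * (p + 1) + 1).factorial : ℝ) =
      (2 * ((p : ℝ) + 1) + 1) * (2 * (p + 1)).factorial := by
    rw [Nat.factorial_succ]; push_cast; ring
  have hN' : ((2 * (p + 1)).factorial : ℝ) ≠ 0 := by positivity
  have hp : (2 * ((p : ℝ) + 1) + 1) ≠ 0 := by positivity
  generalize (∑ k ∈ Finset.Icc 1 p, ((2 * (p + 1) + 1).choose (2 * k + 1) : ℝ) * (1 / 4) ^ k) = s1 at *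
  generalize (∑ k ∈ Finset.Icc 1 p, ((2 * (p + 1) + 1).choose (2 * k + 1) : ℝ) * (1 / 4) ^ k *
          (harmonic (2 * (p + 1) - 2 * k) : ℝ)) = s2 at *
  generalize (∑ k ∈ Finset.Icc 1 p, ((2 * (p + 1) + 1).choose (2 * k + 1) : ℝ) * (1 / 4) ^ k *
          derivZetaNegEven (p + 1 - k)) = s3 at *
  have hL : derivZetaNegEven (p + 1) / (2 * (p + 1)).factorial =
      (2 * ((p : ℝ) + 1) + 1) * derivZetaNegEven (p + 1) / (2 * (p + 1) + 1).factorial := by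
    rw [hf]
    field_simp
  rw [hL, div_eq_iff hN]
  generalize zetaSubOneSeries (p + 1) = S at *
  generalize ((2 * (p + 1) + 1).factorial : ℝ) = F at *
  have hR : (1 / F * (3 / 2) ^ (2 * (p + 1) + 1) *
        (log (3 / 2) - 1 / (2 * ((p + 1 : ℕ) : ℝ) + 1)) -
      ((harmonic (2 * (p + 1)) : ℝ) * s1 - s2 + s3) / F -
      (3 * ((harmonic (2 * (p + 1)) : ℝ) - 0) - log (2 * π)) / (F * 2 ^ (2 * (p + 1) + 1)) -
      1 / 2 ^ (2 * (p + 1)) * S) * F =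
      (3 / 2) ^ (2 * (p + 1) + 1) * (log (3 / 2) - (2 * ((p : ℝ) + 1) + 1)⁻¹) -
      ((harmonic (2 * (p + 1)) : ℝ) * s1 - s2 + s3) -
      (1 / 2) ^ (2 * (p + 1) + 1) * (3 * (harmonic (2 * (p + 1)) : ℝ) - log (2 * π)) -
      (1 / 2) ^ (2 * (p + 1)) * F * S := by
    simp only [one_div_pow]
    push_cast
    generalize (3 / 2 : ℝ) ^ (2 * (p + 1) + 1) = t
    field_simp
    ring
  rw [hR]
  push_cast at hS hC
  rw [pow_succ (1 / 2 : ℝ)] at hS hC ⊢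
  linear_combination hS + (harmonic (2 * (p + 1)) : ℝ) * hC

lemma tsum_pnat_riemannZeta_sub_one (n : ℕ) :
    ∑' l : ℕ+, (riemannZeta (2 * (l : ℕ)) - 1) / (2 ^ (2 * (l : ℕ)) *
      ∏ r ∈ Finset.range (2 * n + 2), (2 * ((l : ℕ) : ℂ) + (r : ℂ))) =
      (zetaSubOneSeries n : ℂ) := by
  rw [tsum_pnat_eq_tsum_succ (f := fun l : ℕ => (riemannZeta (2 * (l : ℂ)) - 1) / (2 ^ (2 * l) *
      ∏ r ∈ Finset.range (2 * n + 2), (2 * (l : ℂ) + (r : ℂ)))), zetaSubOneSeries,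
    Complex.ofReal_tsum]
  congr 1
  ext l
  have h := riemannZeta_eq_zetaNat (s := 2 * (l + 1)) (by omega)
  push_cast at h ⊢
  rw [h]

lemma sum_Icc_add_deriv_riemannZeta (n : ℕ) :
    ∑ k ∈ Finset.Icc 1 (n - 1),
      ((A n k : ℂ) + deriv riemannZeta (-2 * (n : ℂ) + 2 * (k : ℂ))) /
        ((Nat.factorial (2 * n - 2 * k) : ℂ) * (Nat.factorial (2 * k + 1) : ℂ) * 2 ^ (2 * k)) =
    ((∑ k ∈ Finset.Icc 1 (n - 1), (A n k + derivZetaNegEven (n - k)) /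
      ((2 * n - 2 * k).factorial * (2 * k + 1).factorial * 2 ^ (2 * k)) : ℝ) : ℂ) := by
  rw [Complex.ofReal_sum]
  refine Finset.sum_congr rfl fun k hk => ?_
  have hk' := Finset.mem_Icc.1 hk
  have h := deriv_riemannZeta_neg_two_mul (m := n - k) (by omega)
  rw [← derivZetaNegEven, Nat.cast_sub (by omega : k ≤ n)] at h
  rw [show -2 * (n : ℂ) + 2 * (k : ℂ) = -(2 * ((n : ℂ) - k)) by ring, h]
  push_cast
  rfl

theorem zeta_odd_formula (n : ℕ) (hn : 1 ≤ n) :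
    riemannZeta (2 * n + 1) =
      (-1) ^ n * (π : ℂ) ^ (2 * n) * 2 ^ (1 + 2 * n) *
        ((1 / (Nat.factorial (2 * n + 1) : ℂ)) * (3 / 2) ^ (2 * n + 1) *
            ((Real.log (3 / 2) : ℂ) - 1 / (2 * (n : ℂ) + 1)) -
          (∑ k ∈ Finset.Icc 1 (n - 1),
            ((A n k : ℂ) + deriv riemannZeta (-2 * (n : ℂ) + 2 * (k : ℂ))) /
              ((Nat.factorial (2 * n - 2 * k) : ℂ) * (Nat.factorial (2 * k + 1) : ℂ) *
                2 ^ (2 * k))) -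
          (3 * (A n n : ℂ) - (Real.log (2 * π) : ℂ)) /
            ((Nat.factorial (2 * n + 1) : ℂ) * 2 ^ (2 * n + 1)) -
          (1 / 2 ^ (2 * n)) *
            ∑' l : ℕ+, (riemannZeta (2 * (l : ℕ)) - 1) /
              (2 ^ (2 * (l : ℕ)) *
                ∏ r ∈ Finset.range (2 * n + 2), (2 * ((l : ℕ) : ℂ) + (r : ℂ)))) := by
  have h := congrArg (fun x : ℝ => (x : ℂ)) (derivZetaNegEven_eq hn)
  have hz := riemannZeta_eq_zetaNat (s := 2 * n + 1) (by omega)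
  have hD : zetaNat (2 * n + 1) = (-1) ^ n * π ^ (2 * n) * 2 ^ (1 + 2 * n) *
      (derivZetaNegEven n / (2 * n).factorial) := by
    have hf : ((2 * n).factorial : ℝ) ≠ 0 := by positivity
    have h1 : ((-1 : ℝ) ^ n) * (-1) ^ n = 1 := by rw [← mul_pow]; norm_num
    rw [derivZetaNegEven, mul_pow, pow_add]
    field_simp
    linear_combination -zetaNat (2 * n + 1) * h1
  rw [tsum_pnat_riemannZeta_sub_one, sum_Icc_add_deriv_riemannZeta]
  push_cast at hz
  rw [hz, hD]
  simp only [Complex.ofReal_sub, Complex.ofReal_mul, Complex.ofReal_div] at h ⊢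
  rw [h]
  push_cast
  ring
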